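/- For every integer k ≥ 3 and every constant 0 < η ≤ 1 there exists α > 0 such that the following holds for all sufficiently large n ∈ ℕ: every n-vertex graph G with minimum degree δ(G) ≥ ηn and α_k(G) ≤ αn contains a K_k-tiling covering all but at most ⌊1/η⌋(k−1) vertices of G (an η-quasiperfect K_k-tiling). -/

import Mathlib

open Finset

namespace RTT

variable {k n : ℕ}

/-- `S` spans a copy of the `k`-vertex graph `F` in `G`:
there is an injective graph homomorphism from `F` to `G` with image exactly `S`. -/
def SpansCopy (F : SimpleGraph (Fin k)) (G : SimpleGraph (Fin n))
    (S : Finset (Fin n)) : Prop :=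
  ∃ f : Fin k → Fin n, Function.Injective f ∧
    (∀ a b, F.Adj a b → G.Adj (f a) (f b)) ∧ Finset.image f Finset.univ = S

/-- `T` is an `F`-tiling in `G`: a collection of pairwise vertex-disjoint vertex sets,
each spanning a copy of `F`. -/
def IsTiling (F : SimpleGraph (Fin k)) (G : SimpleGraph (Fin n))
    (T : Finset (Finset (Fin n))) : Prop :=
  (∀ S ∈ T, SpansCopy F G S) ∧ ∀ S ∈ T, ∀ S' ∈ T, S ≠ S' → Disjoint S S'

/-- The induced subgraph of `G` on the vertex set `A` has a perfect `F`-tiling. -/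
def PerfTilingOn (F : SimpleGraph (Fin k)) (G : SimpleGraph (Fin n))
    (A : Finset (Fin n)) : Prop :=
  ∃ T : Finset (Finset (Fin n)), IsTiling F G T ∧ T.biUnion id = A

/-- The minimum degree of `G` is at least `x`. -/
def MinDegGE (G : SimpleGraph (Fin n)) (x : ℝ) : Prop :=
  ∀ v : Fin n, x ≤ ((G.neighborSet v).ncard : ℝ)

/-- The `r`-independence number of `G` is at most `x`: every vertex set whose induced
subgraph contains no copy of `K_r` has size at most `x`. -/
def IndepBound (G : SimpleGraph (Fin n)) (r : ℕ) (x : ℝ) : Prop :=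
  ∀ S : Finset (Fin n), (∀ T ⊆ S, ¬ G.IsNClique r T) → (S.card : ℝ) ≤ x

/-- `α*(G) ≤ x`: every bipartite hole of `G` has size at most `x`. -/
def HoleBound (G : SimpleGraph (Fin n)) (x : ℝ) : Prop :=
  ∀ (s : ℕ) (U₁ U₂ : Finset (Fin n)), Disjoint U₁ U₂ → U₁.card = s → U₂.card = s →
    (∀ u ∈ U₁, ∀ v ∈ U₂, ¬ G.Adj u v) → (s : ℝ) ≤ x

/-- `A` is a `ξ`-absorbing set with respect to `V'` (for the `k`-vertex graph `F`
in the `n`-vertex graph `G`). -/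
def IsAbsorbingSet (F : SimpleGraph (Fin k)) (G : SimpleGraph (Fin n)) (ξ : ℝ)
    (V' A : Finset (Fin n)) : Prop :=
  ∀ U : Finset (Fin n), U ⊆ V' \ A → (U.card : ℝ) ≤ ξ * n →
    k ∣ (A ∪ U).card → PerfTilingOn F G (A ∪ U)

/-- `A` is an `(F,t)`-absorber for the `k`-set `S`. -/
def IsAbsorber (F : SimpleGraph (Fin k)) (G : SimpleGraph (Fin n)) (t : ℕ)
    (S A : Finset (Fin n)) : Prop :=
  Disjoint A S ∧ A.card ≤ k ^ 2 * t ∧ PerfTilingOn F G A ∧ PerfTilingOn F G (A ∪ S)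

/-- `S` has a family of at least `x` pairwise vertex-disjoint `(F,t)`-absorbers in `G`. -/
def HasManyAbsorbers (F : SimpleGraph (Fin k)) (G : SimpleGraph (Fin n)) (t : ℕ)
    (S : Finset (Fin n)) (x : ℝ) : Prop :=
  ∃ 𝒜 : Finset (Finset (Fin n)), x ≤ (𝒜.card : ℝ) ∧
    (∀ A ∈ 𝒜, IsAbsorber F G t S A) ∧
    ∀ A ∈ 𝒜, ∀ A' ∈ 𝒜, A ≠ A' → Disjoint A A'

/-- `𝒮` is an `F`-fan at `v` in `U`: a collection of pairwise disjoint `(k-1)`-sets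
`S ⊆ U \ {v}` such that `{v} ∪ S` spans a copy of `F`; its size is `𝒮.card`. -/
def IsFan (F : SimpleGraph (Fin k)) (G : SimpleGraph (Fin n)) (v : Fin n)
    (U : Finset (Fin n)) (𝒮 : Finset (Finset (Fin n))) : Prop :=
  (∀ S ∈ 𝒮, S ⊆ U.erase v ∧ S.card = k - 1 ∧ SpansCopy F G (insert v S)) ∧
    ∀ S ∈ 𝒮, ∀ S' ∈ 𝒮, S ≠ S' → Disjoint S S'

/-- `u` and `v` are `(F, m, t)`-reachable in `G`. -/
def FReachable (F : SimpleGraph (Fin k)) (G : SimpleGraph (Fin n)) (m : ℝ) (t : ℕ)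
    (u v : Fin n) : Prop :=
  ∀ W : Finset (Fin n), (W.card : ℝ) ≤ m →
    ∃ S : Finset (Fin n), Disjoint S W ∧ u ∉ S ∧ v ∉ S ∧ S.card ≤ k * t - 1 ∧
      PerfTilingOn F G (insert u S) ∧ PerfTilingOn F G (insert v S)

/-- `U` is `(F, m, t)`-closed in `G`. -/
def FClosed (F : SimpleGraph (Fin k)) (G : SimpleGraph (Fin n)) (m : ℝ) (t : ℕ)
    (U : Finset (Fin n)) : Prop :=
  ∀ u ∈ U, ∀ v ∈ U, u ≠ v → FReachable F G m t u v

/-- `P` is a partition of the vertex set of an `n`-vertex graph into `C` parts. -/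
def IsPartition {C : ℕ} (P : Fin C → Finset (Fin n)) : Prop :=
  (∀ i j, i ≠ j → Disjoint (P i) (P j)) ∧ Finset.univ.biUnion P = Finset.univ

/-- The `k`-vector `v` is `(F, β)`-robust with respect to the partition `P`:
it has coordinate sum `k`, and avoiding any set `W` of at most `βn` vertices there is
a copy of `F` whose vertex set has index vector `v`. -/
def RobustVec (F : SimpleGraph (Fin k)) (G : SimpleGraph (Fin n)) {C : ℕ}
    (P : Fin C → Finset (Fin n)) (β : ℝ) (v : Fin C → ℕ) : Prop :=
  (∑ i, v i) = k ∧
    ∀ W : Finset (Fin n), (W.card : ℝ) ≤ β * n →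
      ∃ S : Finset (Fin n), Disjoint S W ∧ SpansCopy F G S ∧ ∀ i, (S ∩ P i).card = v i

end RTT


namespace QT

set_option linter.unusedSectionVars false

variable {V : Type*} [Fintype V] [DecidableEq V]

/-- perfectly tileable sets -/
inductive Tl (G : SimpleGraph V) (k : ℕ) : Finset V → Prop
  | empty : Tl G k ∅
  | add (S T : Finset V) : Tl G k S → G.IsNClique k T → Disjoint S T → Tl G k (S ∪ T)

theorem Tl.union {G : SimpleGraph V} {k : ℕ} {A B : Finset V} (hA : Tl G k A) (hB : Tl G k B)
    (h : Disjoint A B) : Tl G k (A ∪ B) := by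
  induction hB with
  | empty => simpa using hA
  | add S T hS hT hd ih =>
    rw [Finset.disjoint_union_right] at h
    rw [← Finset.union_assoc]
    exact Tl.add _ _ (ih h.1) hT (Finset.disjoint_union_left.2 ⟨h.2, hd⟩)

theorem Tl.clique {G : SimpleGraph V} {k : ℕ} {T : Finset V} (hT : G.IsNClique k T) :
    Tl G k T := by
  have := Tl.add ∅ T (Tl.empty (G := G) (k := k)) hT (by simp)
  simpa using this

theorem spans_of_clique {n k : ℕ} {G : SimpleGraph (Fin n)} {T : Finset (Fin n)}
    (hT : G.IsNClique k T) : RTT.SpansCopy (⊤ : SimpleGraph (Fin k)) G T := by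
  refine ⟨fun i => T.orderEmbOfFin hT.card_eq i, (T.orderEmbOfFin hT.card_eq).injective, ?_, ?_⟩
  · intro a b hab
    apply hT.isClique
    · exact Finset.orderEmbOfFin_mem _ _ _
    · exact Finset.orderEmbOfFin_mem _ _ _
    · intro h
      exact hab ((T.orderEmbOfFin hT.card_eq).injective h)
  · exact Finset.image_orderEmbOfFin_univ T hT.card_eq

theorem Tl.tiling {n k : ℕ} {G : SimpleGraph (Fin n)} {A : Finset (Fin n)} (h : Tl G k A) :
    ∃ T : Finset (Finset (Fin n)), RTT.IsTiling (⊤ : SimpleGraph (Fin k)) G T ∧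
      T.biUnion id = A := by
  induction h with
  | empty => exact ⟨∅, ⟨by simp, by simp⟩, by simp⟩
  | add S T hS hT hd ih =>
    obtain ⟨P, ⟨h1, h2⟩, h3⟩ := ih
    have hsub : ∀ Q ∈ P, Disjoint Q T := by
      intro Q hQ
      refine Finset.disjoint_of_subset_left ?_ hd
      rw [← h3]
      exact Finset.subset_biUnion_of_mem id hQ
    refine ⟨insert T P, ⟨?_, ?_⟩, ?_⟩
    · intro Q hQ
      rcases Finset.mem_insert.1 hQ with rfl | hQ
      · exact spans_of_clique hT
      · exact h1 Q hQ
    · intro Q hQ Q' hQ' hne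
      rcases Finset.mem_insert.1 hQ with e1 | hQ1 <;>
      rcases Finset.mem_insert.1 hQ' with e2 | hQ2
      · exact absurd (e1.trans e2.symm) hne
      · rw [e1]; exact (hsub _ hQ2).symm
      · rw [e2]; exact hsub _ hQ1
      · exact h2 _ hQ1 _ hQ2 hne
    · rw [Finset.biUnion_insert, h3, Finset.union_comm]; rfl

/-- every set of more than `a` vertices contains a `k`-clique -/
def HI (G : SimpleGraph V) (k a : ℕ) : Prop :=
  ∀ S : Finset V, a < S.card → ∃ T ⊆ S, G.IsNClique k T

open Classical in
/-- neighbourhood -/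
noncomputable def Nb (G : SimpleGraph V) (v : V) : Finset V := Finset.univ.filter (fun w => G.Adj v w)

theorem mem_Nb {G : SimpleGraph V} {v w : V} : w ∈ Nb G v ↔ G.Adj v w := by
  classical
  simp [Nb]

theorem greedy_rest {G : SimpleGraph V} {k a : ℕ} (hk : 1 ≤ k) (h : HI G k a) :
    ∀ (m : ℕ) (S : Finset V), S.card = m → ∃ L ⊆ S, L.card ≤ a ∧ Tl G k (S \ L) := by
  intro m
  induction m using Nat.strong_induction_on with
  | _ m ih =>
    intro S hS
    by_cases hc : S.card ≤ a
    · exact ⟨S, subset_rfl, hc, by simpa using Tl.empty⟩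
    · obtain ⟨T, hTS, hT⟩ := h S (by omega)
      have hcard := Finset.card_sdiff_add_card_eq_card hTS
      have hTc := hT.card_eq
      obtain ⟨L, hL, hLa, hTl⟩ := ih (S \ T).card (by omega) (S \ T) rfl
      refine ⟨L, hL.trans Finset.sdiff_subset, hLa, ?_⟩
      have : S \ L = ((S \ T) \ L) ∪ T := by
        ext x
        have h1 := @hTS x
        have h2 := @hL x
        simp only [Finset.mem_sdiff, Finset.mem_union] at *
        tauto
      rw [this]
      refine Tl.add _ _ hTl hT ?_
      exact Finset.disjoint_of_subset_left Finset.sdiff_subset Finset.sdiff_disjoint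

theorem ext_clique {G : SimpleGraph V} {k a : ℕ} (hk : 1 ≤ k) (h : HI G k a) (Y : Finset V)
    (hY : a < Y.card) : ∃ S ⊆ Y, S.card + 1 = k ∧
      ∀ v, (∀ w ∈ Y, G.Adj v w) → G.IsNClique k (insert v S) := by
  obtain ⟨T, hTY, hT⟩ := h Y hY
  obtain ⟨S, hST, hS⟩ := Finset.exists_subset_card_eq (s := T) (n := k - 1) (by rw [hT.card_eq]; omega)
  refine ⟨S, hST.trans hTY, by omega, ?_⟩
  intro v hv
  have hcl : G.IsNClique (k-1) S := ⟨hT.isClique.subset (by exact_mod_cast hST), hS⟩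
  have := hcl.insert (a := v) (fun b hb => hv b (hTY (hST hb)))
  rwa [Nat.sub_add_cancel hk] at this

theorem greedy_cover {G : SimpleGraph V} {k a : ℕ} (hk : 1 ≤ k) (h : HI G k a) (Y : Finset V) (D : ℕ)
    (Z : Finset V) : Disjoint Z Y → k * Z.card + a ≤ D → 
    (∀ z ∈ Z, D < (Nb G z ∩ Y).card) →
    ∃ Y0 ⊆ Y, Y0.card ≤ k * Z.card ∧ Tl G k (Z ∪ Y0) := by
  induction Z using Finset.induction_on with
  | empty => intro _ _ _; exact ⟨∅, by simp, by simp, by simpa using Tl.empty⟩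
  | insert z Z hz ih =>
    intro hd hc hN
    rw [Finset.card_insert_of_notMem hz] at hc
    rw [Finset.disjoint_insert_left] at hd
    obtain ⟨Y0, hY0, hY0c, hTl⟩ := ih hd.2 (by nlinarith) (fun w hw => hN w (Finset.mem_insert_of_mem hw))
    have h1 := hN z (Finset.mem_insert_self _ _)
    have h2 := Finset.le_card_sdiff Y0 (Nb G z ∩ Y)
    obtain ⟨S, hS, hSc, hcl⟩ := ext_clique hk h ((Nb G z ∩ Y) \ Y0) (by rw [mul_add] at hc; omega)
    have hcl := hcl z (by intro w hw; rw [← mem_Nb]; exact (Finset.mem_inter.1 (Finset.mem_sdiff.1 hw).1).1)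
    have hSY : ∀ x ∈ S, x ∈ Y ∧ x ∉ Y0 := fun x hx => by
      have := hS hx
      simp only [Finset.mem_sdiff, Finset.mem_inter] at this
      tauto
    refine ⟨Y0 ∪ S, Finset.union_subset hY0 (fun x hx => (hSY x hx).1), ?_, ?_⟩
    · rw [Finset.card_insert_of_notMem hz]
      have := Finset.card_union_le Y0 S
      rw [mul_add]; omega
    · have : insert z Z ∪ (Y0 ∪ S) = (Z ∪ Y0) ∪ insert z S := by
        ext x; simp only [Finset.mem_insert, Finset.mem_union]; tauto
      rw [this]
      refine Tl.add _ _ hTl hcl ?_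
      rw [Finset.disjoint_left]
      intro x hx hx'
      rw [Finset.mem_insert] at hx'
      rw [Finset.mem_union] at hx
      have hdd := Finset.disjoint_left.1 hd.2
      rcases hx with hx | hx <;> rcases hx' with rfl | hx'
      · exact hz hx
      · exact hdd hx (hSY x hx').1
      · exact hd.1 (hY0 hx)
      · exact (hSY x hx').2 hx

/-- reachability -/
def Reach (G : SimpleGraph V) (k e M : ℕ) (u v : V) : Prop :=
  u ≠ v ∧ ∀ F : Finset V, F.card ≤ e → ∃ S : Finset V, Disjoint S F ∧ u ∉ S ∧ v ∉ S ∧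
    S.card + 1 ≤ M ∧ Tl G k (insert u S) ∧ Tl G k (insert v S)

theorem Reach.symm {G : SimpleGraph V} {k e M : ℕ} {u v : V} (h : Reach G k e M u v) :
    Reach G k e M v u := by
  refine ⟨h.1.symm, fun F hF => ?_⟩
  obtain ⟨S, h1, h2, h3, h4, h5, h6⟩ := h.2 F hF
  exact ⟨S, h1, h3, h2, h4, h6, h5⟩

theorem Reach.mono {G : SimpleGraph V} {k e M e' M' : ℕ} {u v : V} (h : Reach G k e M u v)
    (he : e' ≤ e) (hM : M ≤ M') : Reach G k e' M' u v := by
  refine ⟨h.1, fun F hF => ?_⟩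
  obtain ⟨S, h1, h2, h3, h4, h5, h6⟩ := h.2 F (hF.trans he)
  exact ⟨S, h1, h2, h3, h4.trans hM, h5, h6⟩

theorem reach_base {G : SimpleGraph V} {k a e : ℕ} (hk : 1 ≤ k) (h : HI G k a) {u v : V}
    (huv : u ≠ v) (hc : e + a < (Nb G u ∩ Nb G v).card) : Reach G k e k u v := by
  refine ⟨huv, fun F hF => ?_⟩
  have h2 := Finset.le_card_sdiff F (Nb G u ∩ Nb G v)
  obtain ⟨S, hS, hSc, hcl⟩ := ext_clique hk h ((Nb G u ∩ Nb G v) \ F) (by omega)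
  have hS' : ∀ x ∈ S, G.Adj u x ∧ G.Adj v x ∧ x ∉ F := fun x hx => by
    have := hS hx
    simp only [Finset.mem_sdiff, Finset.mem_inter, mem_Nb] at this
    tauto
  refine ⟨S, Finset.disjoint_left.2 (fun x hx => (hS' x hx).2.2), fun hu => (hS' u hu).1.ne rfl,
    fun hu => (hS' v hu).2.1.ne rfl, hSc.le, Tl.clique (hcl u ?_), Tl.clique (hcl v ?_)⟩
  · intro w hw
    simp only [Finset.mem_sdiff, Finset.mem_inter, mem_Nb] at hw
    tauto
  · intro w hw
    simp only [Finset.mem_sdiff, Finset.mem_inter, mem_Nb] at hw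
    tauto

open Classical in
theorem reach_trans {G : SimpleGraph V} {k e e' M : ℕ} {u v : V} (huv : u ≠ v)
    (he : e' + M + 1 ≤ e)
    (hc : e' < (Finset.univ.filter (fun w => Reach G k e M u w ∧ Reach G k e M w v)).card) :
    Reach G k e' (M + M) u v := by
  refine ⟨huv, fun F hF => ?_⟩
  obtain ⟨w, hw, hwF⟩ := Finset.exists_mem_notMem_of_card_lt_card (lt_of_le_of_lt hF hc)
  rw [Finset.mem_filter] at hw
  obtain ⟨-, huw, hwv⟩ := hw
  obtain ⟨S, a1, a2, a3, a4, a5, a6⟩ := huw.2 (insert v F) ((Finset.card_insert_le _ _).trans (by omega))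
  obtain ⟨S', b1, b2, b3, b4, b5, b6⟩ := hwv.2 (insert u (F ∪ S))
    ((Finset.card_insert_le _ _).trans (by have := Finset.card_union_le F S; omega))
  rw [Finset.disjoint_insert_right] at a1 b1
  rw [Finset.disjoint_union_right] at b1
  have hSS' := b1.2.2
  have hwu : w ≠ u := huw.1.symm
  have hwv' : w ≠ v := hwv.1
  have e1 : insert u (insert w (S ∪ S')) = insert u S ∪ insert w S' := by
    ext x; simp only [Finset.mem_insert, Finset.mem_union]; tauto
  have e2 : insert v (insert w (S ∪ S')) = insert w S ∪ insert v S' := by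
    ext x; simp only [Finset.mem_insert, Finset.mem_union]; tauto
  refine ⟨insert w (S ∪ S'), ?_, ?_, ?_, ?_, ?_, ?_⟩
  · rw [Finset.disjoint_insert_left, Finset.disjoint_union_left]
    exact ⟨hwF, a1.2, b1.2.1⟩
  · simp only [Finset.mem_insert, Finset.mem_union]; tauto
  · simp only [Finset.mem_insert, Finset.mem_union]; tauto
  · have := Finset.card_insert_le w (S ∪ S')
    have := Finset.card_union_le S S'
    omega
  · rw [e1]
    refine a5.union b5 ?_
    simp only [Finset.disjoint_insert_left, Finset.disjoint_insert_right, Finset.mem_insert]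
    push Not
    exact ⟨⟨hwu, a3⟩, b1.1, hSS'.symm⟩
  · rw [e2]
    refine a6.union b6 ?_
    simp only [Finset.disjoint_insert_left, Finset.disjoint_insert_right, Finset.mem_insert]
    push Not
    exact ⟨⟨hwv'.symm, a1.1⟩, b2, hSS'.symm⟩

theorem union_nb_bound {G : SimpleGraph V} {d g : ℕ} (hd : ∀ v, d ≤ (Nb G v).card) (I : Finset V) :
    (∀ u ∈ I, ∀ v ∈ I, u ≠ v → (Nb G u ∩ Nb G v).card ≤ g) →
    I.card * d ≤ (I.biUnion (Nb G)).card + I.card * I.card * g := by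
  induction I using Finset.induction_on with
  | empty => intro _; simp
  | insert x I hx ih =>
    intro h
    have ih := ih (fun u hu v hv => h u (Finset.mem_insert_of_mem hu) v (Finset.mem_insert_of_mem hv))
    rw [Finset.card_insert_of_notMem hx, Finset.biUnion_insert]
    have h1 := Finset.card_union_add_card_inter (Nb G x) (I.biUnion (Nb G))
    have h2 : (Nb G x ∩ I.biUnion (Nb G)).card ≤ I.card * g := by
      rw [Finset.inter_biUnion]
      apply Finset.card_biUnion_le_card_mul
      intro y hy
      exact h x (Finset.mem_insert_self _ _) y (Finset.mem_insert_of_mem hy)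
        (fun e => hx (e ▸ hy))
    have h3 := hd x
    nlinarith

theorem exists_reach_pair {G : SimpleGraph V} {k a e d r : ℕ} (hk : 1 ≤ k) (h : HI G k a)
    (hd : ∀ v, d ≤ (Nb G v).card)
    (hn : Fintype.card V + (r+1) * (r+1) * (e + a) < (r+1) * d) (I : Finset V)
    (hI : I.card = r + 1) : ∃ u ∈ I, ∃ v ∈ I, u ≠ v ∧ Reach G k e k u v := by
  by_contra hcon
  push Not at hcon
  have := union_nb_bound hd I (g := e + a) (by
    intro u hu v hv huv
    by_contra hlt
    exact hcon u hu v hv huv (reach_base hk h huv (by omega)))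
  have h2 : (I.biUnion (Nb G)).card ≤ Fintype.card V := Finset.card_le_univ _
  rw [hI] at this
  omega

open Classical in
theorem partition_lemma [Nonempty V] (R : ℕ → V → V → Prop) (r c : ℕ)
    (hsymm : ∀ j u v, R j u v → R j v u)
    (hmono : ∀ i j u v, i ≤ j → j ≤ r → R i u v → R j u v)
    (h0 : ∀ I : Finset V, I.card = r + 1 → ∃ u ∈ I, ∃ v ∈ I, u ≠ v ∧ R 0 u v)
    (htr : ∀ j, j < r → ∀ u v, u ≠ v →
      c < (Finset.univ.filter (fun w => R j u w ∧ R j w v)).card → R (j+1) u v) :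
    ∃ (I : Finset V) (p : V → V) (B : Finset V), I.card ≤ r ∧ B.card ≤ r * r * c ∧
      (∀ v, v ∉ B → p v ∈ I) ∧ ∀ u v, u ∉ B → v ∉ B → u ≠ v → p u = p v → R r u v := by
  let P : ℕ → Prop := fun t => ∃ I : Finset V, I.card = t ∧
    ∀ u ∈ I, ∀ v ∈ I, u ≠ v → ¬ R (r + 1 - t) u v
  have hP1 : P 1 := by
    obtain ⟨x⟩ := ‹Nonempty V›
    refine ⟨{x}, by simp, ?_⟩
    intro u hu v hv huv
    simp only [Finset.mem_singleton] at hu hv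
    exact absurd (hu.trans hv.symm) huv
  have hPr : ¬ P (r+1) := by
    rintro ⟨I, hI, h⟩
    obtain ⟨u, hu, v, hv, huv, hR⟩ := h0 I hI
    exact h u hu v hv huv (by simpa using hR)
  have : ∃ t, 1 ≤ t ∧ t ≤ r ∧ P t ∧ ¬ P (t+1) := by
    by_contra hcon
    push Not at hcon
    have : ∀ t, t ≤ r → P (t+1) := by
      intro t
      induction t with
      | zero => intro _; exact hP1
      | succ t ih => intro ht; exact hcon (t+1) (by omega) ht (ih (by omega))
    exact hPr (this r le_rfl)
  obtain ⟨t, ht1, htr', ⟨I, hI, hIR⟩, hPt⟩ := this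
  obtain ⟨s, hs⟩ : ∃ s, s = r - t := ⟨_, rfl⟩
  have e1 : r + 1 - t = s + 1 := by omega
  have e2 : r + 1 - (t+1) = s := by omega
  rw [e1] at hIR
  have hIs : ∀ u ∈ I, ∀ v ∈ I, u ≠ v → ¬ R s u v := fun u hu v hv huv hR =>
    hIR u hu v hv huv (hmono s (s+1) u v (by omega) (by omega) hR)
  have hmax : ∀ J : Finset V, J.card = t + 1 → ∃ u ∈ J, ∃ v ∈ J, u ≠ v ∧ R s u v := by
    intro J hJ
    by_contra hcon
    push Not at hcon
    exact hPt ⟨J, hJ, by rw [e2]; exact hcon⟩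
  let U : V → V → Prop := fun i v => ∀ j ∈ I, j ≠ i → v ≠ j ∧ ¬ R s v j
  have hU : ∀ i ∈ I, ∀ u v, U i u → U i v → u ≠ v → R s u v := by
    intro i hi u v hu hv huv
    have hvn : v ∉ I.erase i := fun h => (hv v (Finset.mem_of_mem_erase h) (Finset.ne_of_mem_erase h)).1 rfl
    have hun : u ∉ insert v (I.erase i) := by
      rw [Finset.mem_insert]; push Not
      exact ⟨huv, fun h => (hu u (Finset.mem_of_mem_erase h) (Finset.ne_of_mem_erase h)).1 rfl⟩
    obtain ⟨x, hx, y, hy, hxy, hR⟩ := hmax (insert u (insert v (I.erase i))) (by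
      rw [Finset.card_insert_of_notMem hun, Finset.card_insert_of_notMem hvn,
        Finset.card_erase_of_mem hi]; omega)
    simp only [Finset.mem_insert, Finset.mem_erase] at hx hy
    rcases hx with rfl | rfl | ⟨hx, hx'⟩ <;> rcases hy with rfl | rfl | ⟨hy, hy'⟩
    · exact absurd rfl hxy
    · exact hR
    · exact absurd hR (hu y hy' hy).2
    · exact hsymm _ _ _ hR
    · exact absurd rfl hxy
    · exact absurd hR (hv y hy' hy).2
    · exact absurd (hsymm _ _ _ hR) (hu x hx' hx).2
    · exact absurd (hsymm _ _ _ hR) (hv x hx' hx).2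
    · exact absurd hR (hIs x hx' y hy' hxy)
  let B : Finset V := Finset.univ.filter (fun v => ∀ i ∈ I, ¬ U i v)
  have hBsub : B ⊆ (I ×ˢ I).biUnion (fun q => if q.1 = q.2 then ∅ else
      Finset.univ.filter (fun w => R s q.1 w ∧ R s w q.2)) := by
    intro v hv
    rw [Finset.mem_filter] at hv
    have hv := hv.2
    have step : ∀ i ∈ I, ∃ j ∈ I, j ≠ i ∧ (v = j ∨ R s v j) := by
      intro i hi
      have := hv i hi
      simp only [U] at this
      push Not at this
      obtain ⟨j, hj, hji, h⟩ := this
      refine ⟨j, hj, hji, ?_⟩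
      by_cases hvj : v = j
      · exact Or.inl hvj
      · exact Or.inr (h hvj)
    obtain ⟨i0, hi0⟩ : I.Nonempty := Finset.card_pos.1 (by omega)
    obtain ⟨j1, hj1, -, h1⟩ := step i0 hi0
    obtain ⟨j2, hj2, h21, h2⟩ := step j1 hj1
    have key : R s v j1 ∧ R s v j2 := by
      rcases h1 with rfl | h1 <;> rcases h2 with h2 | h2
      · exact absurd h2.symm h21
      · exact absurd h2 (hIs _ hj1 _ hj2 h21.symm)
      · subst h2
        exact absurd h1 (hIs _ hj2 _ hj1 h21)
      · exact ⟨h1, h2⟩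
    rw [Finset.mem_biUnion]
    refine ⟨(j1, j2), Finset.mk_mem_product hj1 hj2, ?_⟩
    simp only [h21.symm, if_false, Finset.mem_filter, Finset.mem_univ, true_and]
    exact ⟨hsymm _ _ _ key.1, key.2⟩
  have hBc : B.card ≤ r * r * c := by
    refine (Finset.card_le_card hBsub).trans ?_
    refine (Finset.card_biUnion_le_card_mul _ _ c ?_).trans ?_
    · rintro ⟨i, j⟩ hq
      rw [Finset.mem_product] at hq
      simp only
      split_ifs with hij
      · simp
      · by_contra hlt
        exact hIR i hq.1 j hq.2 hij (htr s (by omega) i j hij (by omega))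
    · rw [Finset.card_product, hI]
      gcongr
  have hex : ∀ v, ∃ i, v ∉ B → i ∈ I ∧ U i v := by
    intro v
    by_cases hv : v ∈ B
    · exact ⟨v, fun h => absurd hv h⟩
    · have hv' := hv
      simp only [B, Finset.mem_filter, Finset.mem_univ, true_and] at hv'
      push Not at hv'
      obtain ⟨i, hi, hi'⟩ := hv'
      exact ⟨i, fun _ => ⟨hi, hi'⟩⟩
  choose p hp using hex
  refine ⟨I, p, B, by omega, hBc, fun v hv => (hp v hv).1, ?_⟩
  intro u v hu hv huv hpuv
  exact hmono s r u v (by omega) le_rfl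
    (hU (p u) (hp u hu).1 u v (hp u hu).2 (hpuv ▸ (hp v hv).2) huv)

open Classical in
theorem choose_X {G : SimpleGraph V} (W : Finset V) (d b c : ℕ)
    (hd : ∀ v, d ≤ (Nb G v ∩ W).card) :
    ∃ X ⊆ W, c * X.card ≤ b * Fintype.card V ∧
      (Finset.univ.filter (fun v => (Nb G v ∩ X).card < b)).card * (d - b) ≤ c * Fintype.card V := by
  obtain ⟨X, hX, hmax⟩ := Finset.exists_max_image W.powerset
    (fun X => (∑ v : V, (min (Nb G v ∩ X).card b : ℤ)) - c * X.card) ⟨∅, by simp⟩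
  rw [Finset.mem_powerset] at hX
  refine ⟨X, hX, ?_, ?_⟩
  · have h0 := hmax ∅ (by simp)
    have h1 : (∑ v : V, (min (Nb G v ∩ X).card b : ℤ)) ≤ ∑ v : V, (b : ℤ) :=
      Finset.sum_le_sum (fun v _ => min_le_right _ _)
    simp only [Finset.sum_const, Finset.card_univ, nsmul_eq_mul] at h1
    simp only [Finset.inter_empty, Finset.card_empty, Nat.cast_zero, mul_zero, sub_zero] at h0
    have h2 : (0:ℤ) ≤ ∑ v : V, (min ((0:ℕ):ℤ) (b:ℤ)) := Finset.sum_nonneg (fun v _ => by simp)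
    simp only [Nat.cast_zero] at h2
    zify
    linarith
  · set Bad := Finset.univ.filter (fun v => (Nb G v ∩ X).card < b) with hBad
    have key : ∀ y ∈ W \ X, (Bad.filter (fun v => y ∈ Nb G v)).card ≤ c := by
      intro y hy
      rw [Finset.mem_sdiff] at hy
      have h1 := hmax (insert y X) (by
        rw [Finset.mem_powerset]; exact Finset.insert_subset hy.1 hX)
      rw [Finset.card_insert_of_notMem hy.2] at h1
      have h2 : (∑ v : V, (min (Nb G v ∩ X).card b : ℤ)) +
          ∑ v : V, (if v ∈ Bad.filter (fun v => y ∈ Nb G v) then (1:ℤ) else 0) ≤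
          ∑ v : V, (min (Nb G v ∩ insert y X).card b : ℤ) := by
        rw [← Finset.sum_add_distrib]
        apply Finset.sum_le_sum
        intro v _
        split_ifs with hv
        · rw [Finset.mem_filter, hBad, Finset.mem_filter] at hv
          rw [Finset.inter_insert_of_mem hv.2, Finset.card_insert_of_notMem (by
            rw [Finset.mem_inter]; tauto)]
          have := hv.1.2
          push_cast
          omega
        · have : (Nb G v ∩ X).card ≤ (Nb G v ∩ insert y X).card :=
            Finset.card_le_card (Finset.inter_subset_inter_left (Finset.subset_insert _ _))
          omega
      rw [Finset.sum_ite_mem, Finset.univ_inter, Finset.sum_const, nsmul_eq_mul, mul_one] at h2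
      push_cast at h1
      zify
      linarith
    have h3 : ∑ v ∈ Bad, (d - b) ≤ ∑ v ∈ Bad, ((W \ X).filter (fun y => y ∈ Nb G v)).card := by
      apply Finset.sum_le_sum
      intro v hv
      rw [hBad, Finset.mem_filter] at hv
      have h4 := hd v
      have h5 : (Nb G v ∩ W) ⊆ (Nb G v ∩ X) ∪ (W \ X).filter (fun y => y ∈ Nb G v) := by
        intro x hx
        simp only [Finset.mem_inter, Finset.mem_union, Finset.mem_filter, Finset.mem_sdiff] at *
        tauto
      have h6 := Finset.card_le_card h5
      have h7 := Finset.card_union_le (Nb G v ∩ X) ((W \ X).filter (fun y => y ∈ Nb G v))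
      omega
    have h4 : ∑ v ∈ Bad, ((W \ X).filter (fun y => y ∈ Nb G v)).card
        = ∑ y ∈ W \ X, (Bad.filter (fun v => y ∈ Nb G v)).card :=
      Finset.sum_card_bipartiteAbove_eq_sum_card_bipartiteBelow _
    have h5 : ∑ y ∈ W \ X, (Bad.filter (fun v => y ∈ Nb G v)).card ≤ ∑ y ∈ W \ X, c :=
      Finset.sum_le_sum key
    rw [Finset.sum_const, smul_eq_mul] at h3 h5
    have h6 : (W \ X).card ≤ Fintype.card V := Finset.card_le_univ _
    calc Bad.card * (d - b) ≤ (W \ X).card * c := by rw [h4] at h3; exact h3.trans h5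
      _ ≤ Fintype.card V * c := Nat.mul_le_mul_right _ h6
      _ = _ := mul_comm _ _

theorem swap_lemma {G : SimpleGraph V} {k e M : ℕ} {U : Finset V}
    (hU : ∀ u ∈ U, ∀ v ∈ U, u ≠ v → Reach G k e M u v) (m : ℕ) :
    ∀ Q T F : Finset V, Q ⊆ U → T ⊆ U → Q.card = m → T.card = m → Disjoint Q T →
      F.card + m * M + 2 * m ≤ e →
      ∃ S : Finset V, Disjoint S F ∧ Disjoint S Q ∧ Disjoint S T ∧ S.card ≤ m * M ∧
        Tl G k (S ∪ Q) ∧ Tl G k (S ∪ T) := by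
  induction m with
  | zero =>
    intro Q T F _ _ hQ hT _ _
    rw [Finset.card_eq_zero] at hQ hT
    subst hQ hT
    exact ⟨∅, by simp, by simp, by simp, by simp, by simpa using Tl.empty, by simpa using Tl.empty⟩
  | succ m ih =>
    intro Q T F hQU hTU hQ hT hd hF
    obtain ⟨q, Q', hq, rfl, hQ'⟩ := Finset.card_eq_succ.1 hQ
    obtain ⟨t, T', ht, rfl, hT'⟩ := Finset.card_eq_succ.1 hT
    rw [Finset.insert_subset_iff] at hQU hTU
    simp only [Finset.disjoint_insert_left, Finset.disjoint_insert_right, Finset.mem_insert] at hd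
    push Not at hd
    obtain ⟨⟨htq, htQ⟩, hqT, hdQT⟩ := hd
    have hF1 : (insert q (insert t F)).card ≤ F.card + 2 := by
      have := Finset.card_insert_le q (insert t F)
      have := Finset.card_insert_le t F
      omega
    obtain ⟨S, s1, s2, s3, s4, s5, s6⟩ := ih Q' T' (insert q (insert t F)) hQU.2 hTU.2 hQ' hT' hdQT
      (by rw [add_mul] at hF; omega)
    obtain ⟨S', r1, r2, r3, r4, r5, r6⟩ := (hU q hQU.1 t hTU.1 (Ne.symm htq)).2 (F ∪ S ∪ Q' ∪ T') (by
      have h1 := Finset.card_union_le (F ∪ S ∪ Q') T'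
      have h2 := Finset.card_union_le (F ∪ S) Q'
      have h3 := Finset.card_union_le F S
      rw [add_mul] at hF; omega)
    simp only [Finset.disjoint_insert_right, Finset.disjoint_union_right] at s1 r1
    obtain ⟨s1q, s1t, s1F⟩ := s1
    obtain ⟨⟨⟨r1F, r1S⟩, r1Q⟩, r1T⟩ := r1
    have e1 : (S ∪ S') ∪ insert q Q' = (S ∪ Q') ∪ insert q S' := by
      ext x; simp only [Finset.mem_insert, Finset.mem_union]; tauto
    have e2 : (S ∪ S') ∪ insert t T' = (S ∪ T') ∪ insert t S' := by
      ext x; simp only [Finset.mem_insert, Finset.mem_union]; tauto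
    refine ⟨S ∪ S', ?_, ?_, ?_, ?_, ?_, ?_⟩
    · rw [Finset.disjoint_union_left]; exact ⟨s1F, r1F⟩
    · simp only [Finset.disjoint_union_left, Finset.disjoint_insert_right, Finset.mem_union]
      tauto
    · simp only [Finset.disjoint_union_left, Finset.disjoint_insert_right, Finset.mem_union]
      tauto
    · have := Finset.card_union_le S S'
      rw [add_mul]; omega
    · rw [e1]
      refine s5.union r5 ?_
      simp only [Finset.disjoint_union_left, Finset.disjoint_insert_right, Finset.mem_union]
      exact ⟨by tauto, r1S.symm, r1Q.symm⟩
    · rw [e2]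
      refine s6.union r6 ?_
      simp only [Finset.disjoint_union_left, Finset.disjoint_insert_right, Finset.mem_union]
      exact ⟨by tauto, r1S.symm, r1T.symm⟩

theorem abs_k {G : SimpleGraph V} {k a e M : ℕ} (h : HI G k a) {U : Finset V}
    (hU : ∀ u ∈ U, ∀ v ∈ U, u ≠ v → Reach G k e M u v) (hUc : e + a < U.card)
    (Q F : Finset V) (hQU : Q ⊆ U) (hQ : Q.card = k) (hF : F.card + (k * M + 2 * k) ≤ e) :
    ∃ N : Finset V, Disjoint N F ∧ Disjoint N Q ∧ N.card ≤ k * M + 2 * k ∧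
      Tl G k N ∧ Tl G k (N ∪ Q) := by
  have h1 := Finset.le_card_sdiff (F ∪ Q) U
  have h2 := Finset.card_union_le F Q
  obtain ⟨T, hTU, hT⟩ := h (U \ (F ∪ Q)) (by omega)
  have hTd : Disjoint T (F ∪ Q) := Finset.disjoint_of_subset_left hTU Finset.sdiff_disjoint
  rw [Finset.disjoint_union_right] at hTd
  obtain ⟨S, s1, s2, s3, s4, s5, s6⟩ := swap_lemma hU k Q T F hQU (hTU.trans Finset.sdiff_subset)
    hQ hT.card_eq hTd.2.symm (by omega)
  refine ⟨S ∪ T, ?_, ?_, ?_, s6, ?_⟩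
  · rw [Finset.disjoint_union_left]; exact ⟨s1, hTd.1⟩
  · rw [Finset.disjoint_union_left]; exact ⟨s2, hTd.2⟩
  · have := Finset.card_union_le S T
    have := hT.card_eq
    omega
  · rw [Finset.union_right_comm]
    refine Tl.add _ _ s5 hT ?_
    rw [Finset.disjoint_union_left]; exact ⟨s3, hTd.2.symm⟩

theorem abs_mult {G : SimpleGraph V} {k a e M : ℕ} (h : HI G k a) {U : Finset V}
    (hU : ∀ u ∈ U, ∀ v ∈ U, u ≠ v → Reach G k e M u v) (hUc : e + a < U.card) (q : ℕ) :
    ∀ (Q F : Finset V), Q ⊆ U → Q.card = q * k → F.card + q * (k * M + 3 * k) ≤ e →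
    ∃ N : Finset V, Disjoint N F ∧ Disjoint N Q ∧ N.card ≤ q * (k * M + 3 * k) ∧
      Tl G k N ∧ Tl G k (N ∪ Q) := by
  induction q with
  | zero =>
    intro Q F _ hQ _
    rw [zero_mul, Finset.card_eq_zero] at hQ
    subst hQ
    exact ⟨∅, by simp, by simp, by simp, Tl.empty, by simpa using Tl.empty⟩
  | succ q ih =>
    intro Q F hQU hQ hF
    obtain ⟨Q1, hQ1, hQ1c⟩ := Finset.exists_subset_card_eq (s := Q) (n := k) (by rw [hQ]; nlinarith)
    have hc := Finset.card_sdiff_add_card_eq_card hQ1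
    have hQ2 : (Q \ Q1).card = q * k := by rw [add_mul] at hQ; omega
    have hqk : q * k ≤ q * (k * M + 3 * k) := Nat.mul_le_mul_left _ (by omega)
    obtain ⟨N1, a1, a2, a3, a4, a5⟩ := abs_k h hU hUc Q1 (F ∪ (Q \ Q1)) (hQ1.trans hQU) hQ1c (by
      have := Finset.card_union_le F (Q \ Q1)
      rw [add_mul] at hF; omega)
    obtain ⟨N2, b1, b2, b3, b4, b5⟩ := ih (Q \ Q1) (F ∪ Q1 ∪ N1) (Finset.sdiff_subset.trans hQU) hQ2 (by
      have := Finset.card_union_le (F ∪ Q1) N1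
      have := Finset.card_union_le F Q1
      rw [add_mul] at hF; omega)
    simp only [Finset.disjoint_union_right] at a1 b1
    refine ⟨N1 ∪ N2, ?_, ?_, ?_, a4.union b4 b1.2.symm, ?_⟩
    · rw [Finset.disjoint_union_left]; exact ⟨a1.1, b1.1.1⟩
    · rw [← Finset.sdiff_union_of_subset hQ1]
      simp only [Finset.disjoint_union_left, Finset.disjoint_union_right]
      tauto
    · have := Finset.card_union_le N1 N2
      rw [add_mul]; omega
    · have e1 : N1 ∪ N2 ∪ Q = (N1 ∪ Q1) ∪ (N2 ∪ (Q \ Q1)) := by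
        conv_lhs => rw [← Finset.sdiff_union_of_subset hQ1]
        ext x; simp only [Finset.mem_union]; tauto
      rw [e1]
      refine a5.union b5 ?_
      simp only [Finset.disjoint_union_left, Finset.disjoint_union_right]
      exact ⟨⟨b1.2.symm, b1.1.2.symm⟩, a1.2, Finset.disjoint_sdiff⟩

theorem abs_family {G : SimpleGraph V} {k a e M : ℕ} (hk : 1 ≤ k) (h : HI G k a) {U : Finset V}
    (hU : ∀ u ∈ U, ∀ v ∈ U, u ≠ v → Reach G k e M u v) (hUc : e + a < U.card)
    (W F : Finset V) (hW : W ⊆ U) (𝒬 : Finset (Finset V)) :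
    (∀ Q ∈ 𝒬, Q ⊆ W ∧ k ∣ Q.card) →
    F.card + W.card + 𝒬.card * (W.card * (k * M + 3 * k)) ≤ e →
    ∃ N : Finset V, Disjoint N F ∧ Disjoint N W ∧ N.card ≤ 𝒬.card * (W.card * (k * M + 3 * k)) ∧
      Tl G k N ∧ ∀ Q ∈ 𝒬, Tl G k (N ∪ Q) := by
  induction 𝒬 using Finset.induction_on with
  | empty => intro _ _; exact ⟨∅, by simp, by simp, by simp, Tl.empty, by simp⟩
  | insert Q 𝒬 hQ ih =>
    intro h1 h2
    rw [Finset.card_insert_of_notMem hQ, add_mul, one_mul] at h2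
    obtain ⟨N, n1, n2, n3, n4, n5⟩ := ih (fun Q' hQ' => h1 Q' (Finset.mem_insert_of_mem hQ')) (by omega)
    obtain ⟨hQW, q, hq⟩ := h1 Q (Finset.mem_insert_self _ _)
    have hQc := Finset.card_le_card hQW
    have hqW : q ≤ W.card := by nlinarith
    have hqW' : q * (k * M + 3 * k) ≤ W.card * (k * M + 3 * k) := Nat.mul_le_mul_right _ hqW
    obtain ⟨N', m1, m2, m3, m4, m5⟩ := abs_mult h hU hUc q Q (F ∪ W ∪ N) (hQW.trans hW)
      (by rw [hq, mul_comm]) (by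
        have := Finset.card_union_le (F ∪ W) N
        have := Finset.card_union_le F W
        omega)
    simp only [Finset.disjoint_union_right] at m1
    refine ⟨N ∪ N', ?_, ?_, ?_, n4.union m4 m1.2.symm, ?_⟩
    · rw [Finset.disjoint_union_left]; exact ⟨n1, m1.1.1⟩
    · rw [Finset.disjoint_union_left]; exact ⟨n2, m1.1.2⟩
    · have := Finset.card_union_le N N'
      rw [Finset.card_insert_of_notMem hQ, add_mul]; omega
    · intro Q' hQ'
      rcases Finset.mem_insert.1 hQ' with rfl | hQ'
      · rw [Finset.union_assoc]
        refine n4.union m5 ?_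
        rw [Finset.disjoint_union_right]
        exact ⟨m1.2.symm, Finset.disjoint_of_subset_right hQW n2⟩
      · rw [Finset.union_right_comm]
        refine (n5 Q' hQ').union m4 ?_
        rw [Finset.disjoint_union_left]
        refine ⟨m1.2.symm, Finset.disjoint_of_subset_left (h1 Q' (Finset.mem_insert_of_mem hQ')).1 m1.1.2.symm⟩

/-- the size of a local absorber -/
def C0 (k M : ℕ) : ℕ := 2 ^ (2 * k + 1) * ((2 * k + 1) * (k * M + 3 * k))

theorem abs_local {G : SimpleGraph V} {k a e M : ℕ} (hk : 1 ≤ k) (h : HI G k a) {U : Finset V}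
    (hU : ∀ u ∈ U, ∀ v ∈ U, u ≠ v → Reach G k e M u v) (hUc : e + a < U.card)
    (W F : Finset V) (hW : W ⊆ U) (hWc : W.card ≤ 2 * k + 1)
    (hF : F.card + (2 * k + 1) + C0 k M ≤ e) :
    ∃ N : Finset V, Disjoint N F ∧ Disjoint N W ∧ N.card ≤ C0 k M ∧
      ∀ Q ⊆ W, k ∣ Q.card → Tl G k (N ∪ Q) := by
  classical
  have hc : (W.powerset.filter (fun Q => k ∣ Q.card)).card * (W.card * (k * M + 3 * k)) ≤ C0 k M := by
    unfold C0
    refine Nat.mul_le_mul ?_ (Nat.mul_le_mul_right _ hWc)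
    refine (Finset.card_filter_le _ _).trans ?_
    rw [Finset.card_powerset]
    exact Nat.pow_le_pow_right (by norm_num) hWc
  obtain ⟨N, h1, h2, h3, h4, h5⟩ := abs_family hk h hU hUc W F hW
    (W.powerset.filter (fun Q => k ∣ Q.card)) (by
      intro Q hQ
      rw [Finset.mem_filter, Finset.mem_powerset] at hQ
      exact hQ) (by omega)
  refine ⟨N, h1, h2, h3.trans hc, fun Q hQ hkQ => h5 Q ?_⟩
  rw [Finset.mem_filter, Finset.mem_powerset]
  exact ⟨hQ, hkQ⟩

/-- the cost per flexible vertex -/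
def C1 (k M : ℕ) : ℕ := C0 k M + 2 * k + 2

theorem abs_set {G : SimpleGraph V} {k a e M : ℕ} (hk : 1 ≤ k) (h : HI G k a) {U : Finset V}
    (hU : ∀ u ∈ U, ∀ v ∈ U, u ≠ v → Reach G k e M u v) (hUc : e + a < U.card) (m : ℕ) :
    ∀ (X F : Finset V), X ⊆ U → X.card = m → F.card + C1 k M * (m + 1) ≤ e →
    ∃ A : Finset V, Disjoint A F ∧ Disjoint A X ∧ A.card ≤ C1 k M * (m + 1) ∧
      ∀ X' ⊆ X, k ∣ X'.card → Tl G k (A ∪ X') := by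
  induction m with
  | zero =>
    intro X F hX hXc hF
    unfold C1 at *
    obtain ⟨N, h1, h2, h3, h4⟩ := abs_local hk h hU hUc X F hX (by omega) (by omega)
    exact ⟨N, h1, h2, by omega, h4⟩
  | succ m ih =>
    intro X F hX hXc hF
    have hm : m + 1 ≤ C1 k M * (m + 1) := Nat.le_mul_of_pos_left _ (by unfold C1; omega)
    have hC : C1 k M = C0 k M + 2 * k + 2 := rfl
    rw [mul_add, mul_one] at hF
    by_cases hsmall : X.card ≤ 2 * k + 1
    · obtain ⟨N, h1, h2, h3, h4⟩ := abs_local hk h hU hUc X F hX hsmall (by omega)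
      exact ⟨N, h1, h2, by rw [mul_add, mul_one]; omega, h4⟩
    · obtain ⟨W, hWX, hWc⟩ := Finset.exists_subset_card_eq (s := X) (n := k + 1) (by omega)
      have hYc := Finset.card_sdiff_add_card_eq_card hWX
      have hFX := Finset.card_union_le F X
      have hU1 := Finset.le_card_sdiff (F ∪ X) U
      obtain ⟨E, hEU, hEc⟩ := Finset.exists_subset_card_eq (s := U \ (F ∪ X)) (n := k) (by omega)
      have hEd : Disjoint E (F ∪ X) := Finset.disjoint_of_subset_left hEU Finset.sdiff_disjoint
      have hEU' := hEU.trans Finset.sdiff_subset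
      rw [Finset.disjoint_union_right] at hEd
      have hEW : Disjoint E W := Finset.disjoint_of_subset_right hWX hEd.2
      have hEY : Disjoint E (X \ W) := Finset.disjoint_of_subset_right Finset.sdiff_subset hEd.2
      have hWE := Finset.card_union_le W E
      obtain ⟨A1, p1, p2, p3, p4⟩ := abs_local hk h hU hUc (W ∪ E) (F ∪ (X \ W))
        (Finset.union_subset (hWX.trans hX) hEU') (by omega) (by
          have := Finset.card_union_le F (X \ W)
          omega)
      have hYE : ((X \ W) ∪ E).card = m := by
        rw [Finset.card_union_of_disjoint hEY.symm]; omega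
      obtain ⟨A2, q1, q2, q3, q4⟩ := ih ((X \ W) ∪ E) (F ∪ W ∪ A1)
        (Finset.union_subset (Finset.sdiff_subset.trans hX) hEU') hYE (by
          have := Finset.card_union_le (F ∪ W) A1
          have := Finset.card_union_le F W
          omega)
      simp only [Finset.disjoint_union_right] at p1 p2 q1 q2
      have hXeq : (X \ W) ∪ W = X := Finset.sdiff_union_of_subset hWX
      refine ⟨A1 ∪ A2 ∪ E, ?_, ?_, ?_, ?_⟩
      · simp only [Finset.disjoint_union_left]
        exact ⟨⟨p1.1, q1.1.1⟩, hEd.1⟩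
      · rw [← hXeq]
        simp only [Finset.disjoint_union_left, Finset.disjoint_union_right]
        tauto
      · have := Finset.card_union_le (A1 ∪ A2) E
        have := Finset.card_union_le A1 A2
        rw [mul_add, mul_one]; omega
      · intro X' hX' hkX'
        have hc1 := Finset.card_sdiff_add_card_inter X' W
        obtain ⟨E', hE', hE'c⟩ := Finset.exists_subset_card_eq (s := E)
          (n := (k - (X' \ W).card % k)) (by omega)
        have hmod := Nat.mod_lt (X' \ W).card hk
        have hdm := Nat.div_add_mod (X' \ W).card k
        have hc2 := Finset.card_sdiff_add_card_eq_card hE'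
        have hYX : X' \ W ⊆ X \ W := Finset.sdiff_subset_sdiff hX' subset_rfl
        have t2 := q4 ((X' \ W) ∪ E') (Finset.union_subset_union hYX hE') (by
          rw [Finset.card_union_of_disjoint
            (Finset.disjoint_of_subset_left hYX (Finset.disjoint_of_subset_right hE' hEY.symm)), hE'c]
          refine ⟨(X' \ W).card / k + 1, ?_⟩
          rw [mul_add, mul_one]; omega)
        have t1 := p4 ((X' ∩ W) ∪ (E \ E'))
          (Finset.union_subset_union Finset.inter_subset_right Finset.sdiff_subset) (by
          rw [Finset.card_union_of_disjoint
            (Finset.disjoint_of_subset_left Finset.inter_subset_right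
              (Finset.disjoint_of_subset_right Finset.sdiff_subset hEW.symm))]
          have e0 : (X' ∩ W).card + (E \ E').card + k * ((X' \ W).card / k) = X'.card := by omega
          have := (Nat.dvd_add_left (a := k) (b := (X' ∩ W).card + (E \ E').card)
            (c := k * ((X' \ W).card / k)) ⟨_, rfl⟩).1 (by rw [e0]; exact hkX')
          exact this)
        have e1 : A1 ∪ A2 ∪ E ∪ X' = (A1 ∪ ((X' ∩ W) ∪ (E \ E'))) ∪ (A2 ∪ ((X' \ W) ∪ E')) := by
          ext x
          have := @hE' x
          simp only [Finset.mem_union, Finset.mem_inter, Finset.mem_sdiff]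
          tauto
        rw [e1]
        refine t1.union t2 ?_
        have f1 : Disjoint A1 (X' \ W) := Finset.disjoint_of_subset_right hYX p1.2
        have f2 : Disjoint A1 E' := Finset.disjoint_of_subset_right hE' p2.2
        have f3 : Disjoint (X' ∩ W) A2 := Finset.disjoint_of_subset_left Finset.inter_subset_right q1.1.2.symm
        have f4 : Disjoint (X' ∩ W) (X' \ W) :=
          Finset.disjoint_of_subset_left Finset.inter_subset_right Finset.disjoint_sdiff
        have f5 : Disjoint (X' ∩ W) E' := Finset.disjoint_of_subset_left Finset.inter_subset_right
          (Finset.disjoint_of_subset_right hE' hEW.symm)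
        have f6 : Disjoint (E \ E') A2 := Finset.disjoint_of_subset_left Finset.sdiff_subset q2.2.symm
        have f7 : Disjoint (E \ E') (X' \ W) := Finset.disjoint_of_subset_left Finset.sdiff_subset
          (Finset.disjoint_of_subset_right hYX hEY)
        have f8 := q1.2.symm
        have f9 : Disjoint (E \ E') E' := Finset.sdiff_disjoint
        simp only [Finset.disjoint_union_left, Finset.disjoint_union_right]
        tauto

theorem set_eq1 (A A' P Q D1 D2 : Finset V) (d1 : D1 ⊆ P) (f1 : D2 ⊆ Q) (hPQ : Disjoint P Q) :
    A ∪ A' ∪ ((P ∪ Q) \ (D1 ∪ D2)) = (A ∪ (P \ D1)) ∪ (A' ∪ (Q \ D2)) := by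
  ext x
  have g1 := @d1 x
  have g2 := @f1 x
  have g3 : x ∈ P → x ∉ Q := fun hx => Finset.disjoint_left.1 hPQ hx
  simp only [Finset.mem_union, Finset.mem_sdiff]
  clear d1 f1 hPQ
  grind

theorem prop_eq2 (x a z y l x0 d : Prop) (g1 : d → x ∧ ¬ x0) (g2 : z → ¬ x ∧ ¬ a) (g3 : a → ¬ x)
    (g4 : l → ¬ x ∧ ¬ a ∧ ¬ z ∧ ¬ y) (g5 : y → ¬ x ∧ ¬ a ∧ ¬ z) (_g6 : x0 → x) :
    ¬ d ↔ ((z ∨ y) ∨ (¬ (((x ∨ a) ∨ z) ∨ y)) ∧ ¬ l) ∨ ((l ∨ x0) ∨ (a ∨ ((x ∧ ¬ x0) ∧ ¬ d))) := by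
  grind

theorem prop_disj3 (x a z y l x0 d : Prop) (g2 : z → ¬ x ∧ ¬ a)
    (g4 : l → ¬ x ∧ ¬ a ∧ ¬ z ∧ ¬ y) (g5 : y → ¬ x ∧ ¬ a ∧ ¬ z) (g6 : x0 → x)
    (h1 : (z ∨ y) ∨ (¬ (((x ∨ a) ∨ z) ∨ y)) ∧ ¬ l)
    (h2 : (l ∨ x0) ∨ (a ∨ ((x ∧ ¬ x0) ∧ ¬ d))) : False := by
  grind

theorem abs_parts {G : SimpleGraph V} {k a e M : ℕ} (hk : 1 ≤ k) (h : HI G k a)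
    (p : V → V) (U : V → Finset V) (X : Finset V) (I : Finset V) :
    (∀ i ∈ I, ∀ u ∈ U i, ∀ v ∈ U i, u ≠ v → Reach G k e M u v) →
    (∀ i ∈ I, e + a < (U i).card) →
    (∀ i ∈ I, ∀ x ∈ X, p x = i → x ∈ U i) →
    X.card + I.card * (C1 k M * (X.card + 1)) ≤ e →
    ∃ A : Finset V, Disjoint A X ∧ A.card ≤ I.card * (C1 k M * (X.card + 1)) ∧
      ∀ X' ⊆ X, (∀ x ∈ X', p x ∈ I) → ∃ D ⊆ X', D.card ≤ I.card * (k - 1) ∧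
        Tl G k (A ∪ (X' \ D)) := by
  induction I using Finset.induction_on with
  | empty =>
    intro _ _ _ _
    refine ⟨∅, by simp, by simp, ?_⟩
    intro X' _ h1
    have : X' = ∅ := Finset.eq_empty_of_forall_notMem (fun x hx => by simpa using h1 x hx)
    subst this
    exact ⟨∅, by simp, by simp, by simpa using Tl.empty⟩
  | insert i I hi ih =>
    intro h1 h2 h3 h4
    rw [Finset.card_insert_of_notMem hi, add_mul, one_mul] at h4
    obtain ⟨A, a1, a2, a3⟩ := ih (fun j hj => h1 j (Finset.mem_insert_of_mem hj))
      (fun j hj => h2 j (Finset.mem_insert_of_mem hj))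
      (fun j hj => h3 j (Finset.mem_insert_of_mem hj)) (by omega)
    have hXi : (X.filter (fun x => p x = i)).card ≤ X.card := Finset.card_filter_le _ _
    have hXi' : C1 k M * ((X.filter (fun x => p x = i)).card + 1) ≤ C1 k M * (X.card + 1) :=
      Nat.mul_le_mul_left _ (by omega)
    obtain ⟨A', b1, b2, b3, b4⟩ := abs_set hk h (h1 i (Finset.mem_insert_self _ _))
      (h2 i (Finset.mem_insert_self _ _)) _ (X.filter (fun x => p x = i)) (X ∪ A)
      (by
        intro x hx
        rw [Finset.mem_filter] at hx
        exact h3 i (Finset.mem_insert_self _ _) x hx.1 hx.2) rfl (by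
        have := Finset.card_union_le X A
        omega)
    rw [Finset.disjoint_union_right] at b1
    refine ⟨A ∪ A', ?_, ?_, ?_⟩
    · rw [Finset.disjoint_union_left]; exact ⟨a1, b1.1⟩
    · have := Finset.card_union_le A A'
      rw [Finset.card_insert_of_notMem hi, add_mul, one_mul]; omega
    · intro X' hX' hp
      obtain ⟨D1, d1, d2, d3⟩ := a3 (X'.filter (fun x => ¬ p x = i))
        ((Finset.filter_subset _ _).trans hX') (by
          intro x hx
          rw [Finset.mem_filter] at hx
          exact (Finset.mem_insert.1 (hp x hx.1)).resolve_left hx.2)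
      obtain ⟨Q, hQdef⟩ : ∃ Q, Q = X'.filter (fun x => p x = i) := ⟨_, rfl⟩
      obtain ⟨P, hPdef⟩ : ∃ P, P = X'.filter (fun x => ¬ p x = i) := ⟨_, rfl⟩
      have hPQ : P ∪ Q = X' := by
        rw [hPdef, hQdef, Finset.union_comm]; exact Finset.filter_union_filter_not_eq _ _
      have hPQd : Disjoint P Q := by
        rw [hPdef, hQdef]; exact (Finset.disjoint_filter_filter_not _ _ _).symm
      have hQX : Q ⊆ X.filter (fun x => p x = i) := by
        rw [hQdef]; exact Finset.filter_subset_filter _ hX'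
      rw [← hPdef] at d1 d3
      have hmod := Nat.mod_lt Q.card hk
      have hdm := Nat.div_add_mod Q.card k
      obtain ⟨D2, f1, f2⟩ := Finset.exists_subset_card_eq (s := Q) (n := Q.card % k) (Nat.mod_le _ _)
      have hc := Finset.card_sdiff_add_card_eq_card f1
      have t := b4 (Q \ D2) (Finset.sdiff_subset.trans hQX) ⟨Q.card / k, by omega⟩
      have hPX : P ⊆ X := by rw [hPdef]; exact (Finset.filter_subset _ _).trans hX'
      have hQX' : Q ⊆ X := hQX.trans (Finset.filter_subset _ _)
      refine ⟨D1 ∪ D2, ?_, ?_, ?_⟩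
      · rw [← hPQ]; exact Finset.union_subset_union d1 f1
      · have := Finset.card_union_le D1 D2
        rw [Finset.card_insert_of_notMem hi, add_mul, one_mul]; omega
      · have e1 : A ∪ A' ∪ (X' \ (D1 ∪ D2)) = (A ∪ (P \ D1)) ∪ (A' ∪ (Q \ D2)) := by
          rw [← hPQ]
          exact set_eq1 _ _ _ _ _ _ d1 f1 hPQd
        rw [e1]
        refine d3.union t ?_
        have g1 : Disjoint A (Q \ D2) :=
          Finset.disjoint_of_subset_right (Finset.sdiff_subset.trans hQX') a1
        have g2 : Disjoint (P \ D1) A' :=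
          Finset.disjoint_of_subset_left (Finset.sdiff_subset.trans hPX) b1.1.symm
        have g3 : Disjoint (P \ D1) (Q \ D2) :=
          Finset.disjoint_of_subset_left Finset.sdiff_subset
            (Finset.disjoint_of_subset_right Finset.sdiff_subset hPQd)
        have g4 := b1.2.symm
        simp only [Finset.disjoint_union_left, Finset.disjoint_union_right]
        tauto

theorem get_parts [Nonempty V] {G : SimpleGraph V} {k a e d r : ℕ} (hk : 1 ≤ k) (h : HI G k a)
    (hd : ∀ v, d ≤ (Nb G v).card)
    (h1 : Fintype.card V + (r+1) * (r+1) * (e + r * (2 ^ r * k + 1) + a) < (r+1) * d) :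
    ∃ (I : Finset V) (p : V → V) (B : Finset V), I.card ≤ r ∧
      B.card ≤ r * r * (e + r * (2 ^ r * k + 1)) ∧
      (∀ v, v ∉ B → p v ∈ I) ∧
      ∀ u v, u ∉ B → v ∉ B → u ≠ v → p u = p v → Reach G k e (2 ^ r * k) u v := by
  have hpow : ∀ j, j ≤ r → 2 ^ j * k ≤ 2 ^ r * k := fun j hj =>
    Nat.mul_le_mul_right _ (Nat.pow_le_pow_right (by norm_num) hj)
  have := partition_lemma (fun j => Reach G k (e + (r - j) * (2 ^ r * k + 1)) (2 ^ j * k)) r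
    (e + r * (2 ^ r * k + 1)) (fun j u v h => h.symm)
    (fun i j u v hij hj h => h.mono
      (Nat.add_le_add_left (Nat.mul_le_mul_right _ (by omega)) _)
      (Nat.mul_le_mul_right _ (Nat.pow_le_pow_right (by norm_num) hij)))
    (by simpa using exists_reach_pair hk h hd h1)
    (by
      intro j hj u v huv hc
      have e1 : 2 ^ (j+1) * k = 2 ^ j * k + 2 ^ j * k := by ring
      show Reach G k (e + (r - (j+1)) * (2 ^ r * k + 1)) (2 ^ (j+1) * k) u v
      rw [e1]
      have hp := hpow j hj.le
      have e2 : r - j = (r - (j+1)) + 1 := by omega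
      refine reach_trans (e := e + (r - j) * (2 ^ r * k + 1)) huv ?_ ?_
      · rw [e2, add_mul, one_mul]; omega
      · refine lt_of_le_of_lt ?_ hc
        exact Nat.add_le_add_left (Nat.mul_le_mul_right _ (by omega)) _)
  simpa using this

theorem core [Nonempty V] {G : SimpleGraph V} {k a e d r b c β n : ℕ} (hk : 1 ≤ k) (h : HI G k a)
    (hn : Fintype.card V = n)
    (hd : ∀ v, d ≤ (Nb G v).card)
    (h1 : n + (r+1) * (r+1) * (e + r * (2 ^ r * k + 1) + a) < (r+1) * d)
    (hβ : r * r * (e + r * (2 ^ r * k + 1)) + r * (e + a) ≤ β)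
    (h3 : ∀ x, c * x ≤ b * n → x + r * (C1 k (2 ^ r * k) * (x + 1)) ≤ e)
    (h5 : ∀ y, y * (d - β - b) ≤ c * n → (k + 1) * (β + y) + a + e < d)
    (h6 : k * a + a < b) :
    ∃ D : Finset V, D.card ≤ r * (k - 1) ∧ Tl G k (Finset.univ \ D) := by
  classical
  obtain ⟨I, p, B, hI, hB, hp, hR⟩ := get_parts hk h hd (hn ▸ h1)
  let U : V → Finset V := fun i => Finset.univ.filter (fun v => v ∉ B ∧ p v = i)
  obtain ⟨I', hI'⟩ : ∃ I', I' = I.filter (fun i => e + a < (U i).card) := ⟨_, rfl⟩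
  obtain ⟨B', hB'⟩ : ∃ B', B' = B ∪ (I.filter (fun i => ¬ e + a < (U i).card)).biUnion U := ⟨_, rfl⟩
  have hI'c : I'.card ≤ r := by rw [hI']; exact (Finset.card_filter_le _ _).trans hI
  have hB'c : B'.card ≤ β := by
    have g1 : ((I.filter (fun i => ¬ e + a < (U i).card)).biUnion U).card ≤ r * (e + a) := by
      refine (Finset.card_biUnion_le_card_mul _ _ (e + a) ?_).trans ?_
      · intro i hi
        rw [Finset.mem_filter] at hi
        omega
      · exact Nat.mul_le_mul_right _ ((Finset.card_filter_le _ _).trans hI)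
    have := Finset.card_union_le B ((I.filter (fun i => ¬ e + a < (U i).card)).biUnion U)
    rw [hB']; omega
  have hpB' : ∀ v, v ∉ B' → v ∉ B ∧ p v ∈ I' := by
    intro v hv
    rw [hB', Finset.mem_union, Finset.mem_biUnion] at hv
    push Not at hv
    refine ⟨hv.1, ?_⟩
    rw [hI', Finset.mem_filter]
    refine ⟨hp v hv.1, ?_⟩
    by_contra hcon
    exact hv.2 (p v) (Finset.mem_filter.2 ⟨hp v hv.1, by omega⟩)
      (Finset.mem_filter.2 ⟨Finset.mem_univ _, hv.1, rfl⟩)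
  obtain ⟨X, hXW, hXc, hBadc⟩ := choose_X (G := G) (Finset.univ \ B') (d - β) b c (by
    intro v
    have g1 := hd v
    have g2 : Nb G v ∩ (Finset.univ \ B') = Nb G v \ B' := by
      ext x; simp
    rw [g2]
    have := Finset.le_card_sdiff B' (Nb G v)
    omega)
  obtain ⟨Bad, hBad⟩ : ∃ Bad, Bad = Finset.univ.filter (fun v => (Nb G v ∩ X).card < b) := ⟨_, rfl⟩
  rw [← hBad, hn] at hBadc
  rw [hn] at hXc
  have h3 := h3 _ hXc
  have h5 := h5 _ hBadc
  have hXB : ∀ x ∈ X, x ∉ B' := fun x hx => (Finset.mem_sdiff.1 (hXW hx)).2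
  have hIX : I'.card * (C1 k (2 ^ r * k) * (X.card + 1)) ≤ r * (C1 k (2 ^ r * k) * (X.card + 1)) :=
    Nat.mul_le_mul_right _ hI'c
  obtain ⟨A, a1, a2, a3⟩ := abs_parts (e := e) (M := 2 ^ r * k) hk h p U X I'
    (by
      intro i _ u hu v hv huv
      simp only [U, Finset.mem_filter, Finset.mem_univ, true_and] at hu hv
      exact hR u v hu.1 hv.1 huv (hu.2.trans hv.2.symm))
    (by
      intro i hi
      rw [hI', Finset.mem_filter] at hi
      exact hi.2)
    (by
      intro i _ x hx hpx
      simp only [U, Finset.mem_filter, Finset.mem_univ, true_and]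
      exact ⟨(hpB' x (hXB x hx)).1, hpx⟩)
    (by omega)
  have hXA : (X ∪ A).card ≤ e := by
    have := Finset.card_union_le X A
    omega
  obtain ⟨Z, hZ⟩ : ∃ Z, Z = (B' ∪ Bad) \ (X ∪ A) := ⟨_, rfl⟩
  have hZc : Z.card ≤ β + Bad.card := by
    have g1 : Z.card ≤ (B' ∪ Bad).card := by rw [hZ]; exact Finset.card_le_card Finset.sdiff_subset
    have := Finset.card_union_le B' Bad
    omega
  have hZXA : Disjoint Z (X ∪ A) := by rw [hZ]; exact Finset.sdiff_disjoint
  obtain ⟨Y0, y1, -, y3⟩ := greedy_cover hk h (Finset.univ \ (X ∪ A ∪ Z)) (k * Z.card + a) Z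
    (by
      rw [Finset.disjoint_left]; intro x hx hx'
      rw [Finset.mem_sdiff, Finset.mem_union] at hx'
      tauto) le_rfl (by
      intro z _
      have g1 := hd z
      have g2 : Nb G z ∩ (Finset.univ \ (X ∪ A ∪ Z)) = Nb G z \ (X ∪ A ∪ Z) := by
        ext x; simp
      rw [g2]
      have g3 := Finset.le_card_sdiff (X ∪ A ∪ Z) (Nb G z)
      have g4 := Finset.card_union_le (X ∪ A) Z
      have g5 : (k + 1) * Z.card ≤ (k + 1) * (β + Bad.card) := Nat.mul_le_mul_left _ hZc
      rw [add_mul, one_mul] at g5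
      omega)
  obtain ⟨L, l1, l2, l3⟩ := greedy_rest hk h _ (Finset.univ \ (X ∪ A ∪ Z ∪ Y0)) rfl
  have hL : ∀ v ∈ L, v ∉ X ∧ v ∉ A ∧ v ∉ Z ∧ v ∉ Y0 := by
    intro v hv
    have := l1 hv
    simp only [Finset.mem_sdiff, Finset.mem_union, Finset.mem_univ, true_and] at this
    tauto
  have hY0 : ∀ v ∈ Y0, v ∉ X ∧ v ∉ A ∧ v ∉ Z := by
    intro v hv
    have := y1 hv
    simp only [Finset.mem_sdiff, Finset.mem_union, Finset.mem_univ, true_and] at this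
    tauto
  obtain ⟨X0, x1, -, x3⟩ := greedy_cover hk h X (b - 1) L
    (Finset.disjoint_left.2 (fun x hx => (hL x hx).1))
    (by
      have : k * L.card ≤ k * a := Nat.mul_le_mul_left _ l2
      omega)
    (by
      intro v hv
      have g1 := hL v hv
      have g2 : v ∉ Bad := by
        intro hvB
        apply g1.2.2.1
        rw [hZ]
        simp only [Finset.mem_sdiff, Finset.mem_union]
        tauto
      rw [hBad, Finset.mem_filter] at g2
      push Not at g2
      have := g2 (Finset.mem_univ _)
      omega)
  obtain ⟨D, d1, d2, d3⟩ := a3 (X \ X0) Finset.sdiff_subset (by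
    intro x hx
    exact (hpB' x (hXB x (Finset.mem_sdiff.1 hx).1)).2)
  refine ⟨D, d2.trans (Nat.mul_le_mul_right _ hI'c), ?_⟩
  have hD : ∀ v ∈ D, v ∈ X ∧ v ∉ X0 := fun v hv => Finset.mem_sdiff.1 (d1 hv)
  have hZ' : ∀ v ∈ Z, v ∉ X ∧ v ∉ A := by
    intro v hv
    have := Finset.disjoint_left.1 hZXA hv
    rw [Finset.mem_union] at this
    tauto
  have hAX : ∀ v ∈ A, v ∉ X := fun v hv => Finset.disjoint_left.1 a1 hv
  have e1 : Finset.univ \ D = ((Z ∪ Y0) ∪ ((Finset.univ \ (X ∪ A ∪ Z ∪ Y0)) \ L)) ∪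
      ((L ∪ X0) ∪ (A ∪ ((X \ X0) \ D))) := by
    ext v
    simp only [Finset.mem_sdiff, Finset.mem_union, Finset.mem_univ, true_and]
    exact prop_eq2 _ _ _ _ _ _ _ (hD v) (hZ' v) (hAX v) (hL v) (hY0 v) (@x1 v)
  rw [e1]
  refine (y3.union l3 ?_).union (x3.union d3 ?_) ?_
  · rw [Finset.disjoint_left]
    intro v hv hv'
    simp only [Finset.mem_sdiff, Finset.mem_union, Finset.mem_univ, true_and] at hv hv'
    tauto
  · rw [Finset.disjoint_left]
    intro v hv hv'
    have g3 := hAX v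
    have g4 := hL v
    have g6 := @x1 v
    simp only [Finset.mem_sdiff, Finset.mem_union] at hv hv'
    tauto
  · rw [Finset.disjoint_left]
    intro v hv hv'
    simp only [Finset.mem_sdiff, Finset.mem_union, Finset.mem_univ, true_and] at hv hv'
    exact prop_disj3 _ _ _ _ _ _ _ (hZ' v) (hL v) (hY0 v) (@x1 v) hv hv'

set_option maxHeartbeats 4000000 in
theorem params (k r Q C : ℕ) (η : ℝ) (hη : 0 < η) (hη1 : η ≤ 1) (hr : 1 < ((r:ℝ) + 1) * η) :
    ∃ α : ℝ, 0 < α ∧ ∃ N : ℕ, ∀ n : ℕ, N ≤ n → ∃ a e b c β : ℕ, 0 < n ∧ α * n < a + 1 ∧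
      (n + (r+1) * (r+1) * (e + Q + a) < (r+1) * ⌈η * n⌉₊) ∧
      r * r * (e + Q) + r * (e + a) ≤ β ∧
      (∀ x, c * x ≤ b * n → x + r * (C * (x + 1)) ≤ e) ∧
      (∀ y, y * (⌈η * n⌉₊ - β - b) ≤ c * n → (k + 1) * (β + y) + a + e < ⌈η * n⌉₊) ∧
      k * a + a < b := by
  obtain ⟨μ, hμ0, hμη, hμσ⟩ : ∃ μ : ℝ, 0 < μ ∧ μ ≤ η ∧ μ ≤ ((r:ℝ) + 1) * η - 1 :=
    ⟨min η (((r:ℝ) + 1) * η - 1), lt_min hη (by linarith), min_le_left _ _, min_le_right _ _⟩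
  obtain ⟨ρ, hρ⟩ : ∃ ρ : ℝ, ρ = ((r:ℝ)+1) * (r+1) := ⟨_, rfl⟩
  have hr0 : (0:ℝ) ≤ r := Nat.cast_nonneg r
  have hk0 : (0:ℝ) ≤ k := Nat.cast_nonneg k
  have hρ1 : 1 ≤ ρ := by rw [hρ]; nlinarith
  obtain ⟨ε, hε⟩ : ∃ ε : ℝ, ε = μ / (10 * (k + 1) * ρ) := ⟨_, rfl⟩
  have hε0 : 0 < ε := by rw [hε]; positivity
  have hεμ : 10 * (k + 1) * ρ * ε = μ := by rw [hε]; field_simp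
  obtain ⟨Cr, hCr⟩ : ∃ Cr : ℝ, Cr = r * C := ⟨_, rfl⟩
  have hCr0 : 0 ≤ Cr := by rw [hCr]; positivity
  obtain ⟨θ, hθ⟩ : ∃ θ : ℝ, θ = η * ε ^ 2 / (8 * (1 + Cr)) := ⟨_, rfl⟩
  have hθ0 : 0 < θ := by rw [hθ]; positivity
  have hθe : θ * (8 * (1 + Cr)) = η * ε ^ 2 := by rw [hθ]; field_simp
  have hρε : ε ≤ ρ * ε := by nlinarith
  have hkρε : ρ * ε ≤ (k+1) * (ρ * ε) := by nlinarith [mul_nonneg hk0 (by positivity : 0 ≤ ρ * ε)]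
  have hμ10 : 10 * ((k+1) * (ρ * ε)) = μ := by linarith
  have hε1 : ε ≤ 1 := by linarith
  have hθε : θ ≤ ε := by
    have h1 : θ ≤ θ * (8 * (1 + Cr)) := by nlinarith [mul_nonneg hθ0.le hCr0]
    have h2 : η * ε ^ 2 ≤ 1 * (1 * ε) := by
      rw [pow_two]
      exact mul_le_mul hη1 (mul_le_mul_of_nonneg_right hε1 hε0.le) (by positivity) (by norm_num)
    linarith
  obtain ⟨α, hα⟩ : ∃ α : ℝ, α = θ / (2 * (k + 1)) := ⟨_, rfl⟩
  have hα0 : 0 < α := by rw [hα]; positivity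
  have hαe : (k + 1) * α = θ / 2 := by rw [hα]; field_simp
  have hαε : α ≤ ε := by nlinarith
  refine ⟨α, hα0, ⌈Q / ε + 4 / (η * ε) + 2 * Cr / ε + 2 / θ + 1⌉₊, ?_⟩
  intro n hn
  have hn' : Q / ε + 4 / (η * ε) + 2 * Cr / ε + 2 / θ + 1 ≤ (n:ℝ) := Nat.ceil_le.1 hn
  have p1 : 0 ≤ Q / ε := by positivity
  have p2 : 0 ≤ 4 / (η * ε) := by positivity
  have p3 : 0 ≤ 2 * Cr / ε := by positivity
  have p4 : 0 ≤ 2 / θ := by positivity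
  have hn0 : (0:ℝ) < n := by linarith
  have q1 : Q ≤ ε * n := by
    have := (div_le_iff₀ hε0).1 (show Q / ε ≤ n by linarith); linarith
  have q2 : 4 ≤ η * ε * n := by
    have := (div_le_iff₀ (by positivity)).1 (show 4 / (η * ε) ≤ n by linarith); linarith
  have q3 : 2 * Cr ≤ ε * n := by
    have := (div_le_iff₀ hε0).1 (show 2 * Cr / ε ≤ n by linarith); linarith
  have q4 : 2 ≤ θ * n := by
    have := (div_le_iff₀ hθ0).1 (show 2 / θ ≤ n by linarith); linarith
  have hd : η * n ≤ (⌈η * n⌉₊ : ℝ) := Nat.le_ceil _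
  obtain ⟨d, hdd⟩ : ∃ d, d = ⌈η * n⌉₊ := ⟨_, rfl⟩
  rw [← hdd] at hd ⊢
  obtain ⟨a, ha⟩ : ∃ a, a = ⌊α * n⌋₊ := ⟨_, rfl⟩
  obtain ⟨e, he⟩ : ∃ e, e = ⌊ε * n⌋₊ := ⟨_, rfl⟩
  obtain ⟨b, hb⟩ : ∃ b, b = ⌊θ * n⌋₊ := ⟨_, rfl⟩
  obtain ⟨c, hc⟩ : ∃ c, c = ⌊η * ε * n / 2⌋₊ := ⟨_, rfl⟩
  obtain ⟨β, hβ⟩ : ∃ β, β = r * r * (e + Q) + r * (e + a) := ⟨_, rfl⟩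
  have ha1 : (a:ℝ) ≤ α * n := by rw [ha]; exact Nat.floor_le (by positivity)
  have ha2 : α * n < a + 1 := by rw [ha]; exact Nat.lt_floor_add_one _
  have he1 : (e:ℝ) ≤ ε * n := by rw [he]; exact Nat.floor_le (by positivity)
  have hb1 : (b:ℝ) ≤ θ * n := by rw [hb]; exact Nat.floor_le (by positivity)
  have hb2 : θ * n < b + 1 := by rw [hb]; exact Nat.lt_floor_add_one _
  have hc1 : (c:ℝ) ≤ η * ε * n / 2 := by rw [hc]; exact Nat.floor_le (by positivity)
  have hc2 : η * ε * n / 2 < c + 1 := by rw [hc]; exact Nat.lt_floor_add_one _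
  have haε : (a:ℝ) ≤ ε * n := ha1.trans (mul_le_mul_of_nonneg_right hαε hn0.le)
  have hbε : (b:ℝ) ≤ ε * n := hb1.trans (mul_le_mul_of_nonneg_right hθε hn0.le)
  obtain ⟨w, hw⟩ : ∃ w : ℝ, w = ε * n := ⟨_, rfl⟩
  have hw0 : 0 < w := by rw [hw]; positivity
  rw [← hw] at q1 q3 he1 haε hbε
  have hβ1 : (β:ℝ) ≤ 4 * (ρ * w) := by
    rw [hβ]; push_cast
    have g1 : (r:ℝ) * r * (e + Q) ≤ r * r * (2 * w) := mul_le_mul_of_nonneg_left (by linarith) (by positivity)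
    have g2 : (r:ℝ) * (e + a) ≤ r * (2 * w) := mul_le_mul_of_nonneg_left (by linarith) hr0
    rw [hρ]
    have g3 : 0 ≤ (r:ℝ) * w := mul_nonneg hr0 hw0.le
    have g4 : 0 ≤ (r:ℝ) * r * w := by positivity
    linarith
  have hρw : w ≤ ρ * w := le_mul_of_one_le_left hw0.le hρ1
  have hkw : 10 * ((k+1) * (ρ * w)) ≤ η * n := by
    have : 10 * ((k+1) * (ρ * w)) = μ * n := by rw [← hμ10, hw]; ring
    rw [this]; exact mul_le_mul_of_nonneg_right hμη hn0.le
  have hkw' : ρ * w ≤ (k+1) * (ρ * w) := le_mul_of_one_le_left (by positivity) (by linarith)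
  refine ⟨a, e, b, c, β, by exact_mod_cast hn0, ha2, ?_, hβ.ge, ?_, ?_, ?_⟩
  · have g1 : (10:ℝ) * (ρ * w) ≤ (((r:ℝ) + 1) * η - 1) * n := by
      have g2 : 10 * ((k+1) * (ρ * w)) = μ * n := by rw [← hμ10, hw]; ring
      have g3 := mul_le_mul_of_nonneg_right hμσ hn0.le
      linarith
    have g2 : ((r:ℝ)+1) * (η * n) ≤ (r+1) * d := mul_le_mul_of_nonneg_left hd (by linarith)
    have g3 : ρ * (e + Q + a) ≤ ρ * (3 * w) := mul_le_mul_of_nonneg_left (by linarith) (by linarith)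
    have g4 : (n:ℝ) + (r+1) * (r+1) * (e + Q + a) < (r+1) * d := by
      rw [← hρ]; linarith
    exact_mod_cast g4
  · intro x hx
    have hx' : (c:ℝ) * x ≤ b * n := by exact_mod_cast hx
    have hx0 : (0:ℝ) ≤ x := Nat.cast_nonneg x
    have g1 : η * ε * n / 4 ≤ c := by linarith
    have g2 : η * ε * n / 4 * x ≤ θ * n * n :=
      (mul_le_mul_of_nonneg_right g1 hx0).trans (hx'.trans (mul_le_mul_of_nonneg_right hb1 hn0.le))
    have g3 : η * ε * x ≤ 4 * (θ * n) := by
      have : (η * ε * x) * n ≤ (4 * (θ * n)) * n := by linarith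
      exact le_of_mul_le_mul_right this hn0
    have g4 : (x:ℝ) * (1 + Cr) ≤ w / 2 := by
      have g5 : η * ε * x * (2 * (1 + Cr)) ≤ 4 * (θ * n) * (2 * (1 + Cr)) :=
        mul_le_mul_of_nonneg_right g3 (by positivity)
      have g6 : 4 * (θ * n) * (2 * (1 + Cr)) = η * ε * w := by
        rw [hw]
        calc 4 * (θ * n) * (2 * (1 + Cr)) = θ * (8 * (1 + Cr)) * n := by ring
          _ = _ := by rw [hθe]; ring
      have g7 : (η * ε) * (x * (2 * (1 + Cr))) ≤ (η * ε) * w := by linarith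
      have := le_of_mul_le_mul_left g7 (by positivity)
      linarith
    rw [he]
    apply Nat.le_floor
    push_cast
    rw [← hw]
    have : (x:ℝ) + r * (C * (x + 1)) = x * (1 + Cr) + Cr := by rw [hCr]; ring
    rw [this]
    linarith
  · intro y hy
    have hy0 : (0:ℝ) ≤ y := Nat.cast_nonneg y
    have g0 : (d:ℝ) - β - b ≤ ((d - β - b : ℕ) : ℝ) := by
      have : d ≤ (d - β - b) + β + b := by omega
      have : (d:ℝ) ≤ ((d - β - b : ℕ) : ℝ) + β + b := by exact_mod_cast this
      linarith
    have g1 : η * n / 2 ≤ ((d - β - b : ℕ) : ℝ) := by linarith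
    have hy' : (y:ℝ) * ((d - β - b : ℕ) : ℝ) ≤ c * n := by exact_mod_cast hy
    have g2 : y * (η * n / 2) ≤ η * ε * n / 2 * n :=
      (mul_le_mul_of_nonneg_left g1 hy0).trans (hy'.trans (mul_le_mul_of_nonneg_right hc1 hn0.le))
    have g3 : (y:ℝ) ≤ w := by
      have : (η * n / 2) * y ≤ (η * n / 2) * w := by rw [hw]; linarith
      exact le_of_mul_le_mul_left this (by positivity)
    have g4 : ((k:ℝ) + 1) * (β + y) ≤ (k + 1) * (5 * (ρ * w)) :=
      mul_le_mul_of_nonneg_left (by linarith) (by linarith)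
    have g5 : ((k:ℝ) + 1) * (β + y) + a + e < d := by linarith
    exact_mod_cast g5
  · have g1 : ((k:ℝ) + 1) * a ≤ (k+1) * (α * n) := mul_le_mul_of_nonneg_left ha1 (by linarith)
    have g2 : ((k:ℝ) + 1) * (α * n) = θ * n / 2 := by rw [← mul_assoc, hαe]; ring
    have g3 : (k:ℝ) * a + a < b := by linarith
    exact_mod_cast g3

end QT

open RTT in
/-- For every integer `k ≥ 3` and constant `0 < η ≤ 1` there exists `α > 0`
such that for all sufficiently large `n`, every `n`-vertex graph `G` with `δ(G) ≥ ηn` and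
`α_k(G) ≤ αn` contains a `K_k`-tiling covering all but at most `⌊1/η⌋(k-1)` vertices. -/
theorem quasiperfect_clique_tiling_alpha_k :
    ∀ k : ℕ, 3 ≤ k → ∀ η : ℝ, 0 < η → η ≤ 1 →
    ∃ α : ℝ, 0 < α ∧ ∃ N : ℕ, ∀ n : ℕ, N ≤ n →
      ∀ G : SimpleGraph (Fin n),
        MinDegGE G (η * n) → IndepBound G k (α * n) →
        ∃ T : Finset (Finset (Fin n)),
          IsTiling (⊤ : SimpleGraph (Fin k)) G T ∧
          (Finset.univ \ T.biUnion id).card ≤ ⌊1 / η⌋₊ * (k - 1) := by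
  intro k hk η hη hη1
  have hr : 1 < ((⌊1 / η⌋₊ : ℝ) + 1) * η := by
    have := Nat.lt_floor_add_one (1 / η)
    rwa [div_lt_iff₀ hη] at this
  obtain ⟨α, hα, N, hN⟩ := QT.params k ⌊1 / η⌋₊ (⌊1 / η⌋₊ * (2 ^ ⌊1 / η⌋₊ * k + 1))
    (QT.C1 k (2 ^ ⌊1 / η⌋₊ * k)) η hη hη1 hr
  refine ⟨α, hα, N, ?_⟩
  intro n hn G hdeg hind
  obtain ⟨a, e, b, c, β, hn0, ha, h1, hβ, h3, h5, h6⟩ := hN n hn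
  have : Nonempty (Fin n) := ⟨⟨0, hn0⟩⟩
  have hHI : QT.HI G k a := by
    intro S hS
    by_contra hcon
    push Not at hcon
    have g1 := hind S hcon
    have g2 : ((a:ℝ) + 1) ≤ S.card := by exact_mod_cast hS
    linarith
  obtain ⟨D, hD, hT⟩ := QT.core (by omega) hHI (Fintype.card_fin n) (d := ⌈η * n⌉₊) (by
    intro v
    apply Nat.ceil_le.2
    have g1 := hdeg v
    have g2 : (G.neighborSet v).ncard = (QT.Nb G v).card := by
      rw [← Set.ncard_coe_finset]
      congr 1
      ext w
      simp [QT.mem_Nb]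
    rwa [g2] at g1) h1 hβ h3 h5 h6
  obtain ⟨T, hT1, hT2⟩ := hT.tiling
  refine ⟨T, hT1, ?_⟩
  rw [hT2]
  simpa using hD
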